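/- arXiv:1912.09355 — 5 statements merged into one kernel-verified Lean document; each statement's English description precedes it below -/
import Mathlib

section
/- Fix a real number ε with 0 < ε < 1. Then the ratio #{T : T is a numerical set, f(T) = f, m(A(T)) ≤ (1-ε)·f} / 2^(f-1) tends to 0 as f → ∞. -/
open Filter Topology Set

/-- A numerical set: a cofinite subset of ℕ containing 0, not all of ℕ. -/
def IsNumericalSet (T : Set ℕ) : Prop :=
  0 ∈ T ∧ Tᶜ.Finite ∧ Tᶜ.Nonempty

/-- A numerical semigroup: a numerical set closed under addition. -/
def IsNumericalSemigroup (S : Set ℕ) : Prop :=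
  IsNumericalSet S ∧ ∀ a ∈ S, ∀ b ∈ S, a + b ∈ S

/-- Frobenius number: the largest element of the complement. -/
noncomputable def frob (T : Set ℕ) : ℕ := sSup Tᶜ

/-- The associated semigroup `A(T) = {t | t + T ⊆ T}`. -/
def AT (T : Set ℕ) : Set ℕ := {t : ℕ | ∀ x ∈ T, t + x ∈ T}

/-- Multiplicity: the smallest positive element. -/
noncomputable def mult (S : Set ℕ) : ℕ := sInf {x | x ∈ S ∧ 0 < x}

/-- `R(S) = f(S) - m(S)` as an integer. -/
noncomputable def RVal (S : Set ℕ) : ℤ := (frob S : ℤ) - (mult S : ℤ)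

/-- `P(S)`: the number of numerical sets whose associated semigroup is `S`. -/
noncomputable def PCount (S : Set ℕ) : ℕ :=
  {T : Set ℕ | IsNumericalSet T ∧ AT T = S}.ncard

/-- The density `μ(S) = P(S) / 2^(f(S)-1)`. -/
noncomputable def density (S : Set ℕ) : ℝ :=
  (PCount S : ℝ) / 2 ^ (frob S - 1)

/-- The numerical semigroup `N(D,f) = {0} ∪ {f - l : l ∈ D} ∪ (f, ∞)`. -/
def NSet (D : Finset ℕ) (f : ℕ) : Set ℕ :=
  {0} ∪ (fun l => f - l) '' (D : Set ℕ) ∪ {x | f < x}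

/-- `B(D,f)`: numerical sets `T` with `f(T) = f` and
`A(T) ∩ [f - Max D, f - 1] = {f - l : l ∈ D}`. -/
def BSet (D : Finset ℕ) (f : ℕ) : Set (Set ℕ) :=
  {T | IsNumericalSet T ∧ frob T = f ∧
    AT T ∩ Set.Icc (f - D.sup id) (f - 1) = (fun l => f - l) '' (D : Set ℕ)}

/-- `A_D = |B(D, 2 Max D + 1)|`. -/
noncomputable def AConst (D : Finset ℕ) : ℕ :=
  (BSet D (2 * D.sup id + 1)).ncard

/-- `B_l(k,f) = {T ∈ B({k},f) : T ∩ [1,l] = ∅}`. -/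
def BlSet (l k f : ℕ) : Set (Set ℕ) :=
  {T | T ∈ BSet {k} f ∧ T ∩ Set.Icc 1 l = ∅}

/-- `C_{l,k}`. -/
noncomputable def CConst (l k : ℕ) : ℕ :=
  if l ≤ k then (BlSet l k (2 * k + 1)).ncard else (BlSet l k (l + k + 1)).ncard

/-- `G_l(f) = {T : A(T) = N_f, T ∩ [1,l] = ∅}`. -/
def GSet (l f : ℕ) : Set (Set ℕ) :=
  {T | IsNumericalSet T ∧ AT T = NSet ∅ f ∧ T ∩ Set.Icc 1 l = ∅}

/-- Numerical sets with Frobenius number `f` that are stable under translation by `M`. -/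
def shiftStable (f M : ℕ) : Set (Set ℕ) :=
  {T | IsNumericalSet T ∧ frob T = f ∧ M ∈ AT T}

lemma IsNumericalSet.frob_notMem {T : Set ℕ} (hT : IsNumericalSet T) : frob T ∉ T :=
  Nat.sSup_mem hT.2.2 hT.2.1.bddAbove

lemma IsNumericalSet.mem_of_frob_lt {T : Set ℕ} (hT : IsNumericalSet T) {x : ℕ}
    (hx : frob T < x) : x ∈ T := by
  by_contra h
  exact absurd (le_csSup hT.2.1.bddAbove h) (not_le.mpr hx)

lemma mul_mem_AT {T : Set ℕ} {m : ℕ} (hm : m ∈ AT T) (q : ℕ) : q * m ∈ AT T := by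
  induction q with
  | zero => intro x hx; simpa using hx
  | succ q ih =>
    intro x hx
    have := hm _ (ih x hx)
    rwa [← add_assoc, add_comm m, ← Nat.succ_mul] at this

lemma IsNumericalSet.mult_AT_mem {T : Set ℕ} (hT : IsNumericalSet T) :
    mult (AT T) ∈ AT T ∧ 0 < mult (AT T) := by
  have hne : {x | x ∈ AT T ∧ 0 < x}.Nonempty :=
    ⟨frob T + 1, fun x _ => hT.mem_of_frob_lt (by omega), by omega⟩
  exact Nat.sInf_mem hne

open Classical in
/-- A code for `T ∩ [0, f)`: the joint state of each pair `(i, i + M)` with `i < K`, followed by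
the membership of the remaining points. -/
noncomputable def shiftCode (f M K : ℕ) (T : Set ℕ) :
    (Fin K → Fin 3) × (Fin (M - K) → Bool) × (Fin (f - M - K) → Bool) :=
  (fun i => if (i : ℕ) ∈ T then 2 else if (i : ℕ) + M ∈ T then 1 else 0,
    fun j => decide (K + (j : ℕ) ∈ T), fun j => decide (M + K + (j : ℕ) ∈ T))

lemma shiftCode_injOn (f M K : ℕ) : InjOn (shiftCode f M K) (shiftStable f M) := by
  rintro S ⟨hS, hSf, hSM⟩ T ⟨hT, hTf, hTM⟩ h
  simp only [shiftCode, Prod.mk.injEq, funext_iff, Fin.forall_iff, decide_eq_decide] at h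
  obtain ⟨h₁, h₂, h₃⟩ := h
  have hpair : ∀ i < K, (i ∈ S ↔ i ∈ T) ∧ (i + M ∈ S ↔ i + M ∈ T) := by
    intro i hi
    have hi' := h₁ i hi
    have hS' := hSM i
    have hT' := hTM i
    rw [add_comm] at hS' hT'
    by_cases a : i ∈ S <;> by_cases b : i ∈ T <;> by_cases c : i + M ∈ S <;>
      by_cases d : i + M ∈ T <;> simp_all
  ext x
  rcases lt_trichotomy x f with hx | rfl | hx
  · by_cases a : x < K
    · exact (hpair x a).1
    by_cases b : x < M
    · have := h₂ (x - K) (by omega)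
      rwa [show K + (x - K) = x by omega] at this
    by_cases c : x < M + K
    · have := (hpair (x - M) (by omega)).2
      rwa [show x - M + M = x by omega] at this
    · have := h₃ (x - (M + K)) (by omega)
      rwa [show M + K + (x - (M + K)) = x by omega] at this
  · have h₁ := hS.frob_notMem
    have h₂ := hT.frob_notMem
    rw [hSf] at h₁
    rw [hTf] at h₂
    exact iff_of_false h₁ h₂
  · exact iff_of_true (hS.mem_of_frob_lt (hSf ▸ hx)) (hT.mem_of_frob_lt (hTf ▸ hx))

lemma shiftStable_finite (f M : ℕ) : (shiftStable f M).Finite :=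
  Set.Finite.of_injOn (mapsTo_univ _ _) (shiftCode_injOn f M 0) finite_univ

lemma ncard_shiftStable_le {f M K : ℕ} (hKM : K ≤ M) (hKf : K + M ≤ f) :
    (shiftStable f M).ncard ≤ 3 ^ K * 2 ^ (f - 2 * K) := by
  have h := ncard_le_ncard_of_injOn (shiftCode f M K) (fun _ _ => mem_univ _)
    (shiftCode_injOn f M K) finite_univ
  rw [ncard_univ, Nat.card_eq_fintype_card] at h
  simp only [Fintype.card_prod, Fintype.card_fun, Fintype.card_fin, Fintype.card_bool] at h
  rwa [← pow_add, show M - K + (f - M - K) = f - 2 * K by omega] at h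

lemma exists_shift {ε : ℝ} (hε1 : ε < 1) {f K : ℕ}
    (hK₁ : (K : ℝ) ≤ (1 - ε) / 2 * f) (hK₂ : (K : ℝ) ≤ ε * f) {T : Set ℕ}
    (hT : IsNumericalSet T) (hm : (mult (AT T) : ℝ) ≤ (1 - ε) * f) :
    ∃ M, K ≤ M ∧ K + M ≤ f ∧ M ∈ AT T := by
  obtain ⟨hmem, hpos⟩ := hT.mult_AT_mem
  set m := mult (AT T)
  have hpos' : (0 : ℝ) < m := by exact_mod_cast hpos
  have hnonneg : 0 ≤ (1 - ε) * f := by have := sub_pos.mpr hε1; positivity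
  set q := ⌊(1 - ε) * f / m⌋₊
  have hq₁ : (q : ℝ) * m ≤ (1 - ε) * f :=
    (le_div_iff₀ hpos').mp (Nat.floor_le (by positivity))
  have hq₂ : (1 - ε) * f < (q + 1) * m := (div_lt_iff₀ hpos').mp (Nat.lt_floor_add_one _)
  have hq₃ : (1 : ℝ) ≤ q := by
    exact_mod_cast Nat.le_floor (by rw [Nat.cast_one]; exact (one_le_div hpos').mpr hm)
  refine ⟨q * m, ?_, ?_, mul_mem_AT hmem q⟩
  · have : (K : ℝ) ≤ q * m := by nlinarith
    exact_mod_cast this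
  · have : (K : ℝ) + q * m ≤ f := by linarith
    exact_mod_cast this

lemma ncard_small_mult_le {ε : ℝ} (hε1 : ε < 1) {f K : ℕ}
    (hK₁ : (K : ℝ) ≤ (1 - ε) / 2 * f) (hK₂ : (K : ℝ) ≤ ε * f) :
    {T : Set ℕ | IsNumericalSet T ∧ frob T = f ∧ (mult (AT T) : ℝ) ≤ (1 - ε) * f}.ncard ≤
      (f + 1) * (3 ^ K * 2 ^ (f - 2 * K)) := by
  set I := (Finset.range (f + 1)).filter fun M => K ≤ M ∧ K + M ≤ f
  have hsub : {T : Set ℕ | IsNumericalSet T ∧ frob T = f ∧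
      (mult (AT T) : ℝ) ≤ (1 - ε) * f} ⊆ ⋃ M ∈ I, shiftStable f M := by
    rintro T ⟨hT, hf, hm⟩
    obtain ⟨M, h₁, h₂, h₃⟩ := exists_shift hε1 hK₁ hK₂ hT hm
    simp only [mem_iUnion]
    exact ⟨M, by simp only [I, Finset.mem_filter, Finset.mem_range]; omega, hT, hf, h₃⟩
  have hfin : (⋃ M ∈ I, shiftStable f M).Finite :=
    I.finite_toSet.biUnion fun M _ => shiftStable_finite f M
  calc _ ≤ (⋃ M ∈ I, shiftStable f M).ncard := ncard_le_ncard hsub hfin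
    _ ≤ ∑ M ∈ I, (shiftStable f M).ncard := Finset.set_ncard_biUnion_le _ _
    _ ≤ I.card • (3 ^ K * 2 ^ (f - 2 * K)) := Finset.sum_le_card_nsmul _ _ _ fun M hM => by
        simp only [I, Finset.mem_filter] at hM
        exact ncard_shiftStable_le hM.2.1 hM.2.2
    _ ≤ _ := by
        rw [smul_eq_mul]
        gcongr
        simpa using Finset.card_filter_le (Finset.range (f + 1)) fun M => K ≤ M ∧ K + M ≤ f

lemma three_pow_mul_two_pow_div {f K : ℕ} (hf : 1 ≤ f) (hK : 2 * K ≤ f) :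
    (3 ^ K * 2 ^ (f - 2 * K) : ℝ) / 2 ^ (f - 1) = 2 * (3 / 4) ^ K := by
  obtain ⟨d, rfl⟩ := Nat.exists_eq_add_of_le hK
  rw [Nat.add_sub_cancel_left, div_eq_iff (by positivity), div_pow]
  have h : (2 : ℝ) ^ (2 * K + d - 1) * 2 = 4 ^ K * 2 ^ d := by
    rw [← pow_succ, Nat.sub_add_cancel hf, pow_add, pow_mul]
    norm_num
  field_simp
  linear_combination -h

lemma pow_floor_le {r c : ℝ} (hr₀ : 0 < r) (hr₁ : r ≤ 1) (n : ℕ) :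
    r ^ ⌊c * n⌋₊ ≤ r⁻¹ * (r ^ c) ^ n := by
  rw [← Real.rpow_natCast r, ← Real.rpow_mul_natCast hr₀.le, ← Real.rpow_neg_one,
    ← Real.rpow_add hr₀]
  exact Real.rpow_le_rpow_of_exponent_ge hr₀ hr₁ (by linarith [Nat.lt_floor_add_one (c * n)])

theorem stmt0 (ε : ℝ) (hε0 : 0 < ε) (hε1 : ε < 1) :
    Tendsto (fun f : ℕ =>
      (({T : Set ℕ | IsNumericalSet T ∧ frob T = f ∧
          (mult (AT T) : ℝ) ≤ (1 - ε) * f}.ncard : ℝ)) / 2 ^ (f - 1))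
      atTop (nhds 0) := by
  set c := min ((1 - ε) / 2) ε
  have hc : 0 < c := lt_min (by linarith) hε0
  set r : ℝ := (3 / 4) ^ c
  have hr₀ : 0 ≤ r := by positivity
  have hr₁ : r < 1 := Real.rpow_lt_one (by norm_num) (by norm_num) hc
  have hlim : Tendsto (fun f : ℕ => 2 * (3 / 4 : ℝ)⁻¹ * ((f : ℝ) * r ^ f + r ^ f))
      atTop (nhds 0) := by
    simpa using ((tendsto_self_mul_const_pow_of_lt_one hr₀ hr₁).add
      (tendsto_pow_atTop_nhds_zero_of_lt_one hr₀ hr₁)).const_mul (2 * (3 / 4 : ℝ)⁻¹)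
  refine squeeze_zero' (Eventually.of_forall fun f => by positivity) ?_ hlim
  filter_upwards [eventually_ge_atTop 1] with f hf
  set K := ⌊c * f⌋₊
  have hK : (K : ℝ) ≤ c * f := Nat.floor_le (by positivity)
  have hK₁ : (K : ℝ) ≤ (1 - ε) / 2 * f := hK.trans (by gcongr; exact min_le_left _ _)
  have hK₂ : (K : ℝ) ≤ ε * f := hK.trans (by gcongr; exact min_le_right _ _)
  have hKf : 2 * K ≤ f := by
    have : (2 * K : ℝ) ≤ f := by nlinarith [Nat.cast_nonneg (α := ℝ) f]
    exact_mod_cast this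
  calc _ ≤ ((f + 1 : ℝ) * (3 ^ K * 2 ^ (f - 2 * K))) / 2 ^ (f - 1) := by
        gcongr
        exact_mod_cast ncard_small_mult_le hε1 hK₁ hK₂
    _ = 2 * (f + 1) * (3 / 4) ^ K := by
        rw [mul_div_assoc, three_pow_mul_two_pow_div hf hKf]
        ring
    _ ≤ 2 * (f + 1) * ((3 / 4 : ℝ)⁻¹ * r ^ f) := by
        gcongr
        exact pow_floor_le (by norm_num) (by norm_num) f
    _ = _ := by ring
end

section
/- Let D be a finite set of positive integers with t = Max(D) (with Max(∅) = 0) and let f ≥ 2t + 1. Then |B(D,f)| = A_D · 2^(f-2t-1). -/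
open Filter Topology Set

/-- Membership in `B(D,f)` only involves `T ∩ [0, t]` and `T ∩ [f - t, f]`, where `t = Max D`. -/
theorem mem_BSet_iff {D : Finset ℕ} (hD : ∀ d ∈ D, 0 < d) {f : ℕ}
    (hf : 2 * D.sup id + 1 ≤ f) (T : Set ℕ) :
    T ∈ BSet D f ↔ 0 ∈ T ∧ f ∉ T ∧ (∀ x, f < x → x ∈ T) ∧
      ∀ l, 0 < l → l ≤ D.sup id →
        (l ∈ D ↔ l ∉ T ∧ ∀ x < l, x ∈ T → f - (l - x) ∈ T) := by
  have hle : ∀ d ∈ D, d ≤ D.sup id := fun d hd => Finset.le_sup (f := id) hd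
  change (IsNumericalSet T ∧ frob T = f ∧
    AT T ∩ Set.Icc (f - D.sup id) (f - 1) = (fun l => f - l) '' (D : Set ℕ)) ↔ _
  generalize D.sup id = t at *
  have hbase : IsNumericalSet T ∧ frob T = f ↔ 0 ∈ T ∧ f ∉ T ∧ ∀ x, f < x → x ∈ T := by
    constructor
    · rintro ⟨⟨h0, hfin, hne⟩, rfl⟩
      refine ⟨h0, Nat.sSup_mem hne hfin.bddAbove, fun x hx => ?_⟩
      by_contra hxT
      exact absurd (le_csSup hfin.bddAbove hxT) (not_le.mpr hx)
    · rintro ⟨h0, hfT, hT⟩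
      have hub : ∀ x ∈ Tᶜ, x ≤ f := fun x hx => by
        by_contra! h
        exact hx (hT x h)
      have hgr : IsGreatest Tᶜ f := ⟨hfT, hub⟩
      exact ⟨⟨h0, (Set.finite_Iic f).subset hub, ⟨f, hfT⟩⟩, hgr.csSup_eq⟩
  have hAT : f ∉ T → (∀ x, f < x → x ∈ T) → ∀ l, 0 < l → l ≤ t →
      (f - l ∈ AT T ↔ l ∉ T ∧ ∀ x < l, x ∈ T → f - (l - x) ∈ T) := by
    intro hfT hT l hl hlt
    constructor
    · intro h
      refine ⟨fun hlT => hfT ?_, fun x hx hxT => ?_⟩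
      · simpa [show f - l + l = f by omega] using h l hlT
      · simpa [show f - l + x = f - (l - x) by omega] using h x hxT
    · rintro ⟨hlT, h⟩ x hxT
      rcases lt_trichotomy x l with hx | rfl | hx
      · rw [show f - l + x = f - (l - x) by omega]
        exact h x hx hxT
      · exact absurd hxT hlT
      · exact hT _ (by omega)
  have hset : AT T ∩ Set.Icc (f - t) (f - 1) = (fun l => f - l) '' (D : Set ℕ) ↔
      ∀ l, 0 < l → l ≤ t → (l ∈ D ↔ f - l ∈ AT T) := by
    constructor
    · intro h l hl hlt
      constructor
      · intro hlD
        have : f - l ∈ (fun l => f - l) '' (D : Set ℕ) := ⟨l, hlD, rfl⟩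
        rw [← h] at this
        exact this.1
      · intro hA
        have : f - l ∈ AT T ∩ Set.Icc (f - t) (f - 1) := ⟨hA, by omega, by omega⟩
        rw [h] at this
        obtain ⟨d, hd, hdl⟩ := this
        have hdt := hle d hd
        simp only at hdl
        rwa [show l = d by omega]
    · intro h
      ext y
      constructor
      · rintro ⟨hA, hy1, hy2⟩
        have hyf : f - (f - y) = y := by omega
        exact ⟨f - y, (h (f - y) (by omega) (by omega)).2 (hyf.symm ▸ hA), hyf⟩
      · rintro ⟨d, hd, rfl⟩
        have hd0 := hD d hd
        have hdt := hle d hd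
        exact ⟨(h d hd0 hdt).1 hd, by simp only; omega, by simp only; omega⟩
  rw [← and_assoc, hbase, hset]
  constructor
  · rintro ⟨⟨h0, hfT, hT⟩, h⟩
    exact ⟨h0, hfT, hT, fun l hl hlt => (h l hl hlt).trans (hAT hfT hT l hl hlt)⟩
  · rintro ⟨h0, hfT, hT, h⟩
    exact ⟨⟨h0, hfT, hT⟩, fun l hl hlt => (h l hl hlt).trans (hAT hfT hT l hl hlt).symm⟩

/-- Open a gap of length `m` in `T` after position `t`, and fill it with a translate of `S`. -/
def insertBlock (t m : ℕ) (p : Set ℕ × Set ℕ) : Set ℕ :=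
  {x | (x ≤ t ∧ x ∈ p.1) ∨ (t < x ∧ x ≤ t + m ∧ x - (t + 1) ∈ p.2) ∨ (t + m < x ∧ x - m ∈ p.1)}

theorem mem_insertBlock_of_le {t m x : ℕ} (p : Set ℕ × Set ℕ) (hx : x ≤ t) :
    x ∈ insertBlock t m p ↔ x ∈ p.1 := by
  simp [insertBlock, hx, show ¬ t < x by omega, show ¬ t + m < x by omega]

theorem add_mem_insertBlock_of_lt {t m x : ℕ} (p : Set ℕ × Set ℕ) (hx : t < x) :
    x + m ∈ insertBlock t m p ↔ x ∈ p.1 := by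
  simp [insertBlock, show ¬ x + m ≤ t by omega, show ¬ x + m ≤ t + m by omega,
    show t + m < x + m by omega]

theorem add_mem_insertBlock_of_lt_length {t m i : ℕ} (p : Set ℕ × Set ℕ) (hi : i < m) :
    i + (t + 1) ∈ insertBlock t m p ↔ i ∈ p.2 := by
  simp [insertBlock, show ¬ i + (t + 1) ≤ t by omega, show i + (t + 1) ≤ t + m by omega,
    show t < i + (t + 1) by omega, show ¬ t + m < i + (t + 1) by omega]

theorem insertBlock_injOn (t m : ℕ) (A : Set (Set ℕ)) :
    Set.InjOn (insertBlock t m) (A ×ˢ 𝒫 Set.Iio m) := by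
  rintro p ⟨-, hp⟩ q ⟨-, hq⟩ h
  refine Prod.ext (Set.ext fun x => ?_) (Set.ext fun i => ?_)
  · rcases le_or_gt x t with hx | hx
    · rw [← mem_insertBlock_of_le p hx, h, mem_insertBlock_of_le q hx]
    · rw [← add_mem_insertBlock_of_lt p hx, h, add_mem_insertBlock_of_lt q hx]
  · by_cases hi : i < m
    · rw [← add_mem_insertBlock_of_lt_length p hi, h, add_mem_insertBlock_of_lt_length q hi]
    · exact ⟨fun h' => absurd (hp h') hi, fun h' => absurd (hq h') hi⟩

theorem exists_insertBlock_eq (t m : ℕ) (T : Set ℕ) :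
    ∃ p : Set ℕ × Set ℕ, p.2 ⊆ Set.Iio m ∧ insertBlock t m p = T := by
  refine ⟨({x | (x ≤ t ∧ x ∈ T) ∨ (t < x ∧ x + m ∈ T)}, {i | i < m ∧ i + (t + 1) ∈ T}),
    fun i hi => hi.1, Set.ext fun x => ?_⟩
  rcases le_or_gt x t with hx | hx
  · rw [mem_insertBlock_of_le _ hx]
    simp [hx, show ¬ t < x by omega]
  rcases le_or_gt x (t + m) with hxm | hxm
  · obtain ⟨i, rfl⟩ : ∃ i, x = i + (t + 1) := ⟨x - (t + 1), by omega⟩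
    have hi : i < m := by omega
    rw [add_mem_insertBlock_of_lt_length _ hi]
    simp [hi]
  · obtain ⟨y, rfl⟩ : ∃ y, x = y + m := ⟨x - m, by omega⟩
    have hy : t < y := by omega
    rw [add_mem_insertBlock_of_lt _ hy]
    simp [hy, show ¬ y ≤ t by omega]

theorem insertBlock_mem_BSet_iff {D : Finset ℕ} (hD : ∀ d ∈ D, 0 < d) (m : ℕ)
    (p : Set ℕ × Set ℕ) :
    insertBlock (D.sup id) m p ∈ BSet D (2 * D.sup id + 1 + m) ↔
      p.1 ∈ BSet D (2 * D.sup id + 1) := by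
  rw [mem_BSet_iff hD (by omega), mem_BSet_iff hD le_rfl]
  generalize D.sup id = t
  refine and_congr (mem_insertBlock_of_le p (Nat.zero_le t)) (and_congr
    (not_congr (add_mem_insertBlock_of_lt p (by omega))) (and_congr ?_ ?_))
  · constructor
    · intro h x hx
      exact (add_mem_insertBlock_of_lt p (by omega)).1 (h (x + m) (by omega))
    · intro h x hx
      obtain ⟨y, rfl⟩ : ∃ y, x = y + m := ⟨x - m, by omega⟩
      exact (add_mem_insertBlock_of_lt p (by omega)).2 (h y (by omega))
  · refine forall₃_congr fun l hl hlt => iff_congr Iff.rfl (and_congr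
      (not_congr (mem_insertBlock_of_le p hlt)) (forall₂_congr fun x hx => ?_))
    rw [mem_insertBlock_of_le p (by omega),
      show 2 * t + 1 + m - (l - x) = 2 * t + 1 - (l - x) + m by omega,
      add_mem_insertBlock_of_lt p (by omega)]

theorem stmt4 (D : Finset ℕ) (hD : ∀ d ∈ D, 0 < d) (f : ℕ)
    (hf : 2 * D.sup id + 1 ≤ f) :
    (BSet D f).ncard = AConst D * 2 ^ (f - 2 * D.sup id - 1) := by
  obtain ⟨m, rfl⟩ := Nat.exists_eq_add_of_le hf
  have himage : insertBlock (D.sup id) m '' (BSet D (2 * D.sup id + 1) ×ˢ 𝒫 Set.Iio m) =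
      BSet D (2 * D.sup id + 1 + m) := by
    ext T
    constructor
    · rintro ⟨p, ⟨hp, -⟩, rfl⟩
      exact (insertBlock_mem_BSet_iff hD m p).2 hp
    · intro hT
      obtain ⟨p, hp, rfl⟩ := exists_insertBlock_eq (D.sup id) m T
      exact ⟨p, ⟨(insertBlock_mem_BSet_iff hD m p).1 hT, hp⟩, rfl⟩
  rw [← himage, (insertBlock_injOn _ m _).ncard_image, Set.ncard_prod,
    Set.ncard_powerset _ (Set.finite_Iio m), AConst]
  congr 2
  rw [Set.ncard_eq_toFinset_card', Set.toFinset_Iio, Nat.card_Iio]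
  omega
end

section
/- Let l, k be positive integers with k < l and let f ≥ l + k + 1. Then |B_l(k,f)| = C_{l,k} · 2^(f−k−l−1). -/
open Filter Topology Set

theorem isNumericalSet_and_frob_eq_iff (T : Set ℕ) (f : ℕ) :
    IsNumericalSet T ∧ frob T = f ↔ 0 ∈ T ∧ f ∉ T ∧ ∀ x, f < x → x ∈ T := by
  constructor
  · rintro ⟨⟨h0, hfin, hne⟩, rfl⟩
    refine ⟨h0, Nat.sSup_mem hne hfin.bddAbove, fun x hx => ?_⟩
    by_contra hxT
    exact absurd (le_csSup hfin.bddAbove (show x ∈ Tᶜ from hxT)) (not_le.mpr hx)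
  · rintro ⟨h0, hf, hgt⟩
    have hle : ∀ x ∈ Tᶜ, x ≤ f := fun x hx => not_lt.mp fun h => hx (hgt x h)
    exact ⟨⟨h0, (Set.finite_Iic f).subset hle, ⟨f, hf⟩⟩,
      IsGreatest.csSup_eq ⟨hf, hle⟩⟩

/-- Translating `T` by a number within `l` of its Frobenius number keeps it inside `T` as soon as
`T` contains that number and has no element in `[1, l]`. -/
theorem mem_AT_iff_mem {T : Set ℕ} {f l t : ℕ} (h0 : 0 ∈ T) (hgt : ∀ x, f < x → x ∈ T)
    (hl : ∀ x ∈ T, x = 0 ∨ l < x) (ht : f ≤ t + l) : t ∈ AT T ↔ t ∈ T := by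
  refine ⟨fun h => by simpa using h 0 h0, fun h x hx => ?_⟩
  rcases hl x hx with rfl | hlx
  · exact h
  · exact hgt _ (by omega)

theorem mem_BlSet_iff {l k f : ℕ} (hk : 0 < k) (hkl : k < l) (hf : l + k + 1 ≤ f) (T : Set ℕ) :
    T ∈ BlSet l k f ↔ 0 ∈ T ∧ f ∉ T ∧ (∀ x, f < x → x ∈ T) ∧ f - k ∈ T ∧
      (∀ x, f - k < x → x < f → x ∉ T) ∧ ∀ x ∈ T, x = 0 ∨ l < x := by
  have hdisj : T ∩ Set.Icc 1 l = ∅ ↔ ∀ x ∈ T, x = 0 ∨ l < x := by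
    rw [Set.eq_empty_iff_forall_notMem]
    refine forall_congr' fun x => ?_
    simp only [Set.mem_inter_iff, Set.mem_Icc, not_and]
    exact forall_congr' fun _ => by omega
  simp only [BlSet, BSet, Set.mem_ofPred_eq, hdisj]
  rw [← and_assoc (a := IsNumericalSet T), isNumericalSet_and_frob_eq_iff]
  simp only [Finset.sup_singleton, id, Finset.coe_singleton, Set.image_singleton]
  constructor
  · rintro ⟨⟨⟨h0, hfT, hgt⟩, hA⟩, hl⟩
    have hiff : ∀ x, f - k ≤ x → x < f → (x ∈ T ↔ x = f - k) := fun x h1 h2 => by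
      rw [← mem_AT_iff_mem h0 hgt hl (by omega : f ≤ x + l), ← Set.mem_singleton_iff, ← hA]
      simp only [Set.mem_inter_iff, Set.mem_Icc]
      exact ⟨fun h => ⟨h, h1, by omega⟩, fun h => h.1⟩
    exact ⟨h0, hfT, hgt, (hiff _ le_rfl (by omega)).mpr rfl,
      fun x h1 h2 hx => h1.ne' ((hiff x h1.le h2).mp hx), hl⟩
  · rintro ⟨h0, hfT, hgt, hkT, hgap, hl⟩
    refine ⟨⟨⟨h0, hfT, hgt⟩, ?_⟩, hl⟩
    ext x
    simp only [Set.mem_inter_iff, Set.mem_Icc, Set.mem_singleton_iff]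
    constructor
    · rintro ⟨hx, h1, h2⟩
      rw [mem_AT_iff_mem h0 hgt hl (by omega)] at hx
      by_contra hne
      exact hgap x (by omega) (by omega) hx
    · rintro rfl
      exact ⟨(mem_AT_iff_mem h0 hgt hl (by omega)).mpr hkT, le_rfl, by omega⟩

theorem BlSet_eq_image {l k f : ℕ} (hk : 0 < k) (hkl : k < l) (hf : l + k + 1 ≤ f) :
    BlSet l k f = (fun S : Finset ℕ => {x | x = 0 ∨ x ∈ S ∨ x = f - k ∨ f < x}) ''
      ((Finset.Ioo l (f - k)).powerset : Set (Finset ℕ)) := by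
  classical
  ext T
  simp only [mem_BlSet_iff hk hkl hf, Set.mem_image, Finset.mem_coe, Finset.mem_powerset]
  constructor
  · rintro ⟨h0, hfT, hgt, hkT, hgap, hl⟩
    refine ⟨{x ∈ Finset.Ioo l (f - k) | x ∈ T}, Finset.filter_subset _ _, ?_⟩
    ext x
    simp only [Set.mem_ofPred_eq, Finset.mem_filter, Finset.mem_Ioo]
    constructor
    · rintro (rfl | h | rfl | h)
      exacts [h0, h.2, hkT, hgt x h]
    · intro hx
      have h1 := hl x hx
      have h2 : ¬ (f - k < x ∧ x < f) := fun h => hgap x h.1 h.2 hx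
      have h3 : x ≠ f := fun h => hfT (h ▸ hx)
      by_cases h4 : l < x ∧ x < f - k
      · exact Or.inr (Or.inl ⟨h4, hx⟩)
      · omega
  · rintro ⟨S, hS, rfl⟩
    have hmem : ∀ x ∈ S, l < x ∧ x < f - k := fun x hx => Finset.mem_Ioo.mp (hS hx)
    simp only [Set.mem_ofPred_eq]
    refine ⟨by simp, ?_, fun x h => by simp [h], by simp, ?_, ?_⟩
    · rintro (h | h | h | h)
      · omega
      · have := hmem _ h
        omega
      · omega
      · omega
    · rintro x h1 h2 (h | h | h | h)
      · omega
      · have := hmem _ h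
        omega
      · omega
      · omega
    · rintro x (h | h | h | h)
      · omega
      · exact Or.inr (hmem _ h).1
      · omega
      · omega

theorem ncard_BlSet {l k f : ℕ} (hk : 0 < k) (hkl : k < l) (hf : l + k + 1 ≤ f) :
    (BlSet l k f).ncard = 2 ^ (f - k - l - 1) := by
  rw [BlSet_eq_image hk hkl hf, Set.InjOn.ncard_image, Set.ncard_coe_finset,
    Finset.card_powerset, Nat.card_Ioo]
  intro S hS S' hS' h
  simp only [Finset.coe_powerset, Set.mem_preimage, Set.mem_powerset_iff, Finset.coe_subset]
    at hS hS'
  ext x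
  have hx := Set.ext_iff.mp h x
  simp only [Set.mem_ofPred_eq] at hx
  have hmem : x ∈ S → l < x ∧ x < f - k := fun h => Finset.mem_Ioo.mp (hS h)
  have hmem' : x ∈ S' → l < x ∧ x < f - k := fun h => Finset.mem_Ioo.mp (hS' h)
  constructor
  · intro hS
    have := hmem hS
    rcases hx.mp (Or.inr (Or.inl hS)) with h | h | h | h
    exacts [by omega, h, by omega, by omega]
  · intro hS
    have := hmem' hS
    rcases hx.mpr (Or.inr (Or.inl hS)) with h | h | h | h
    exacts [by omega, h, by omega, by omega]

theorem stmt8 (l k : ℕ) (hk : 0 < k) (hkl : k < l) (f : ℕ) (hf : l + k + 1 ≤ f) :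
    (BlSet l k f).ncard = CConst l k * 2 ^ (f - k - l - 1) := by
  have hC : CConst l k = 1 := by
    rw [CConst, if_neg (by omega), ncard_BlSet hk hkl le_rfl,
      show l + k + 1 - k - l - 1 = 0 by omega, pow_zero]
  rw [hC, one_mul, ncard_BlSet hk hkl hf]
end

section
/- For positive integers l and k with k ≥ 2l + 2, one has C_{l,k} ≤ 2^l · 3^(k−2l−1). -/
open Filter Topology Set

lemma add_mem_of_mem_BlSet {l k : ℕ} {T : Set ℕ} (hT : T ∈ BlSet l k (2 * k + 1)) {x : ℕ}
    (hx : x ∈ T) : k + 1 + x ∈ T := by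
  obtain ⟨⟨-, -, hA⟩, -⟩ := hT
  have hmem : 2 * k + 1 - k ∈
      AT T ∩ Set.Icc (2 * k + 1 - ({k} : Finset ℕ).sup id) (2 * k + 1 - 1) :=
    hA ▸ ⟨k, by simp, rfl⟩
  have h := hmem.1 x hx
  rwa [show 2 * k + 1 - k = k + 1 by omega] at h

/-- Elements of `[2k + 1 - l, 2k]` lie outside `A(T)`, and since `T` misses `[1, l]` only `0 ∈ T`
can witness this. -/
lemma notMem_of_mem_BlSet {l k : ℕ} {T : Set ℕ} (hlk : l < k) (hT : T ∈ BlSet l k (2 * k + 1))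
    {y : ℕ} (hy : 2 * k + 1 ≤ y + l) (hy' : y ≤ 2 * k) : y ∉ T := by
  intro hyT
  obtain ⟨⟨hN, hf, hA⟩, hl⟩ := hT
  have hyA : y ∈ AT T := by
    intro x hx
    rcases Nat.eq_zero_or_pos x with rfl | hx0
    · simpa using hyT
    · refine hN.mem_of_frob_lt ?_
      have hxl : l < x := by
        by_contra! hxl
        exact Set.eq_empty_iff_forall_notMem.mp hl x ⟨hx, hx0, hxl⟩
      omega
  have hmem : y ∈ (fun j => 2 * k + 1 - j) '' (({k} : Finset ℕ) : Set ℕ) := by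
    rw [← hA]
    refine ⟨hyA, ?_⟩
    simp only [Finset.sup_singleton, id_eq, Set.mem_Icc]
    omega
  simp only [Finset.coe_singleton, Set.image_singleton, Set.mem_singleton_iff] at hmem
  omega

open Classical in
/-- Records `T` on `[k + 2, k + 1 + l]`, and on the pairs `{x, x + k + 1}` with
`l < x < k - l`. -/
noncomputable def pairCode (l k : ℕ) (T : Set ℕ) :
    (Fin l → Bool) × (Fin (k - 2 * l - 1) → Fin 3) :=
  (fun i => decide (k + 2 + i ∈ T),
    fun j => if l + 1 + j ∈ T then 2 else if k + 1 + (l + 1 + j) ∈ T then 1 else 0)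

lemma mem_iff_of_pairCode_eq {l k : ℕ} {S T : Set ℕ} (hS : S ∈ BlSet l k (2 * k + 1))
    (hT : T ∈ BlSet l k (2 * k + 1)) (h : pairCode l k S = pairCode l k T) {x : ℕ}
    (hx : l < x) (hx' : x + l < k) : (x ∈ S ↔ x ∈ T) ∧ (k + 1 + x ∈ S ↔ k + 1 + x ∈ T) := by
  have h2 := congrFun (congrArg Prod.snd h) ⟨x - (l + 1), by omega⟩
  simp only [pairCode, show l + 1 + (x - (l + 1)) = x by omega] at h2
  have hS' := add_mem_of_mem_BlSet hS (x := x)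
  have hT' := add_mem_of_mem_BlSet hT (x := x)
  split_ifs at h2 <;> simp_all

lemma pairCode_injOn {l k : ℕ} (hlk : l < k) :
    Set.InjOn (pairCode l k) (BlSet l k (2 * k + 1)) := by
  intro S hS T hT h
  have hi : ∀ x, 1 ≤ x → x ≤ l → (k + 1 + x ∈ S ↔ k + 1 + x ∈ T) := by
    intro x h1 h2
    have := congrFun (congrArg Prod.fst h) ⟨x - 1, by omega⟩
    simpa [pairCode, show k + 2 + (x - 1) = k + 1 + x by omega] using this
  have low : ∀ {U : Set ℕ}, U ∈ BlSet l k (2 * k + 1) → ∀ x, 1 ≤ x → x ≤ l → x ∉ U :=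
    fun hU x h1 h2 hx => Set.eq_empty_iff_forall_notMem.mp hU.2 x ⟨hx, h1, h2⟩
  have top : ∀ {U : Set ℕ}, U ∈ BlSet l k (2 * k + 1) → 2 * k + 1 ∉ U :=
    fun hU hx => hU.1.1.frob_notMem (hU.1.2.1.symm ▸ hx)
  have high : ∀ {U : Set ℕ}, U ∈ BlSet l k (2 * k + 1) → ∀ x, k ≤ x + l → x ≤ k →
      k + 1 + x ∉ U := by
    intro U hU x h1 h2
    rcases h2.eq_or_lt with rfl | h2
    · rw [show x + 1 + x = 2 * x + 1 by omega]
      exact top hU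
    · exact notMem_of_mem_BlSet hlk hU (by omega) (by omega)
  have key : ∀ x ≤ k, (x ∈ S ↔ x ∈ T) ∧ (k + 1 + x ∈ S ↔ k + 1 + x ∈ T) := by
    intro x hxk
    rcases Nat.eq_zero_or_pos x with rfl | hx0
    · have hS0 := hS.1.1.1
      have hT0 := hT.1.1.1
      exact ⟨iff_of_true hS0 hT0,
        iff_of_true (add_mem_of_mem_BlSet hS hS0) (add_mem_of_mem_BlSet hT hT0)⟩
    · rcases le_or_gt x l with hxl | hxl
      · exact ⟨iff_of_false (low hS x hx0 hxl) (low hT x hx0 hxl), hi x hx0 hxl⟩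
      · rcases lt_or_ge (x + l) k with hxk' | hxk'
        · exact mem_iff_of_pairCode_eq hS hT h hxl hxk'
        · have hS' := high hS x hxk' hxk
          have hT' := high hT x hxk' hxk
          exact ⟨iff_of_false (fun hx => hS' (add_mem_of_mem_BlSet hS hx))
            (fun hx => hT' (add_mem_of_mem_BlSet hT hx)), iff_of_false hS' hT'⟩
  ext x
  rcases le_or_gt x k with hx | hx
  · exact (key x hx).1
  · rcases le_or_gt x (2 * k + 1) with hx' | hx'
    · have := (key (x - (k + 1)) (by omega)).2
      rwa [show k + 1 + (x - (k + 1)) = x by omega] at this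
    · exact iff_of_true (hS.1.1.mem_of_frob_lt (hS.1.2.1.symm ▸ hx'))
        (hT.1.1.mem_of_frob_lt (hT.1.2.1.symm ▸ hx'))

theorem stmt11 (l k : ℕ) (hl : 0 < l) (hk : 2 * l + 2 ≤ k) :
    CConst l k ≤ 2 ^ l * 3 ^ (k - 2 * l - 1) := by
  rw [CConst, if_pos (by omega)]
  calc (BlSet l k (2 * k + 1)).ncard
      ≤ (Set.univ : Set ((Fin l → Bool) × (Fin (k - 2 * l - 1) → Fin 3))).ncard :=
        Set.ncard_le_ncard_of_injOn (pairCode l k) (fun _ _ => Set.mem_univ _)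
          (pairCode_injOn (by omega)) Set.finite_univ
    _ = 2 ^ l * 3 ^ (k - 2 * l - 1) := by simp [Set.ncard_univ, Nat.card_eq_fintype_card]
end

section
/- Let D be a finite set of positive integers with t = Max(D) (with Max(∅) = 0). Then γ_D ≥ a_t / 2^(t+1), where a_t = (2/3)·4^(−t) − 3·2^t·4^(−2t−1); in particular γ_D > 0. -/
open Filter Topology Set

theorem card_filter_pairs_le (Q : Finset ℕ) (x : ℕ) (G : Finset ℕ) (hQ : Q ⊆ G)
    (hQx : ∀ y ∈ Q, x + y ∈ G) (hd : ∀ y ∈ Q, x + y ∉ Q) :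
    (({U ∈ G.powerset | ∀ y ∈ Q, y ∈ U → x + y ∈ U}.card : ℕ) : ℝ)
      ≤ 2 ^ G.card * (3 / 4) ^ Q.card := by
  induction Q using Finset.induction_on generalizing G with
  | empty => simp
  | insert q Q hq ih =>
    have hqG : q ∈ G := hQ (Finset.mem_insert_self _ _)
    have hqxG : x + q ∈ G := hQx q (Finset.mem_insert_self _ _)
    have hne : x + q ≠ q := fun h =>
      hd q (Finset.mem_insert_self _ _) (by rw [h]; exact Finset.mem_insert_self _ _)
    have hqxQ : x + q ∉ Q := fun h =>
      hd q (Finset.mem_insert_self _ _) (Finset.mem_insert_of_mem h)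
    have hQq : ∀ y ∈ Q, x + y ≠ q := fun y hy h =>
      hd y (Finset.mem_insert_of_mem hy) (h ▸ Finset.mem_insert_self _ _)
    set G' := G \ {q, x + q} with hG'
    have hcard : G'.card + 2 = G.card := by
      rw [hG', ← Finset.card_pair hne.symm]
      exact Finset.card_sdiff_add_card_eq_card
        (by simp [Finset.insert_subset_iff, hqG, hqxG])
    have hih := ih G'
      (fun y hy => by
        have h1 : y ≠ q := fun h => hq (h ▸ hy)
        have h2 : y ≠ x + q := fun h => hqxQ (h ▸ hy)
        simp [hG', h1, h2, hQ (Finset.mem_insert_of_mem hy)])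
      (fun y hy => by
        have h1 : y ≠ q := fun h => hq (h ▸ hy)
        simp [hG', h1, hQq y hy, hQx y (Finset.mem_insert_of_mem hy)])
      (fun y hy h => hd y (Finset.mem_insert_of_mem hy) (Finset.mem_insert_of_mem h))
    have hle : {U ∈ G.powerset | ∀ y ∈ insert q Q, y ∈ U → x + y ∈ U}.card
        ≤ ({U ∈ G'.powerset | ∀ y ∈ Q, y ∈ U → x + y ∈ U} ×ˢ
          ({∅, {x + q}, {q, x + q}} : Finset (Finset ℕ))).card := by
      refine Finset.card_le_card_of_injOn
        (fun U => (U \ {q, x + q}, U ∩ {q, x + q})) ?_ ?_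
      · intro U hU
        simp only [Finset.coe_filter, Finset.mem_powerset, Set.mem_ofPred_eq] at hU
        obtain ⟨hUG, hU⟩ := hU
        simp only [Finset.coe_product, Set.mem_prod, Finset.coe_filter, Finset.mem_powerset,
          Set.mem_ofPred_eq]
        refine ⟨⟨Finset.sdiff_subset_sdiff hUG le_rfl, ?_⟩, ?_⟩
        · intro y hy hyU
          have h1 : y ≠ q := fun h => hq (h ▸ hy)
          simp only [Finset.mem_sdiff, Finset.mem_insert, Finset.mem_singleton] at hyU ⊢
          refine ⟨hU y (Finset.mem_insert_of_mem hy) hyU.1, ?_⟩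
          have := hQq y hy
          omega
        · have hqU := hU q (Finset.mem_insert_self _ _)
          simp only [Finset.coe_insert, Finset.coe_singleton, Set.mem_insert_iff,
            Set.mem_singleton_iff]
          by_cases h1 : q ∈ U
          · have h2 := hqU h1
            right; right
            ext a
            simp only [Finset.mem_inter, Finset.mem_insert, Finset.mem_singleton]
            constructor
            · exact fun h => h.2
            · rintro (rfl | rfl) <;> simp_all
          · by_cases h2 : x + q ∈ U
            · right; left
              ext a
              simp only [Finset.mem_inter, Finset.mem_insert, Finset.mem_singleton]
              constructor
              · rintro ⟨h, rfl | rfl⟩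
                · exact absurd h h1
                · rfl
              · rintro rfl
                exact ⟨h2, Or.inr rfl⟩
            · left
              ext a
              simp only [Finset.mem_inter, Finset.mem_insert, Finset.mem_singleton,
                Finset.notMem_empty, iff_false]
              rintro ⟨h, rfl | rfl⟩
              · exact h1 h
              · exact h2 h
      · intro U _ V _ h
        simp only [Prod.mk.injEq] at h
        rw [← Finset.sdiff_union_inter U {q, x + q}, h.1, h.2, Finset.sdiff_union_inter]
    have h3 : ({∅, {x + q}, {q, x + q}} : Finset (Finset ℕ)).card ≤ 3 := Finset.card_le_three
    rw [Finset.card_product] at hle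
    have hle' := hle.trans (Nat.mul_le_mul_left _ h3)
    rw [Finset.card_insert_of_notMem hq, ← hcard]
    refine (Nat.cast_le (α := ℝ).2 hle').trans ?_
    rw [Nat.cast_mul, Nat.cast_ofNat]
    refine (mul_le_mul_of_nonneg_right hih (by norm_num)).trans_eq ?_
    ring

theorem card_filter_constraints_le (F P Z Q : Finset ℕ) (x : ℕ) (hP : P ⊆ F) (hZ : Z ⊆ F)
    (hPZ : Disjoint P Z) (hQ : Q ⊆ F \ (P ∪ Z)) (hQx : ∀ y ∈ Q, x + y ∈ F \ (P ∪ Z))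
    (hd : ∀ y ∈ Q, x + y ∉ Q) :
    (({U ∈ F.powerset | P ⊆ U ∧ Disjoint U Z ∧ ∀ y ∈ Q, y ∈ U → x + y ∈ U}.card : ℕ) : ℝ)
      ≤ 2 ^ F.card * (1 / 2) ^ (P.card + Z.card) * (3 / 4) ^ Q.card := by
  have hle : {U ∈ F.powerset | P ⊆ U ∧ Disjoint U Z ∧ ∀ y ∈ Q, y ∈ U → x + y ∈ U}.card
      ≤ {U ∈ (F \ (P ∪ Z)).powerset | ∀ y ∈ Q, y ∈ U → x + y ∈ U}.card := by
    refine Finset.card_le_card_of_injOn (fun U => U \ P) ?_ ?_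
    · intro U hU
      simp only [Finset.coe_filter, Finset.mem_powerset, Set.mem_ofPred_eq] at hU ⊢
      obtain ⟨hUF, _, hUZ, hU⟩ := hU
      refine ⟨fun a ha => ?_, fun y hy hyU => ?_⟩
      · simp only [Finset.mem_sdiff, Finset.mem_union] at ha ⊢
        exact ⟨hUF ha.1, fun h => h.elim ha.2 (Finset.disjoint_left.1 hUZ ha.1)⟩
      · have := hQx y hy
        simp only [Finset.mem_sdiff, Finset.mem_union, not_or] at this hyU ⊢
        exact ⟨hU y hy hyU.1, this.2.1⟩
    · intro U hU V hV h
      simp only [Finset.coe_filter, Finset.mem_powerset, Set.mem_ofPred_eq] at hU hV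
      rw [← Finset.sdiff_union_of_subset hU.2.1, ← Finset.sdiff_union_of_subset hV.2.1]
      rw [show U \ P = V \ P from h]
  have hcard : (F \ (P ∪ Z)).card + (P.card + Z.card) = F.card := by
    rw [← Finset.card_union_of_disjoint hPZ]
    exact Finset.card_sdiff_add_card_eq_card (Finset.union_subset hP hZ)
  have h2 : (2 : ℝ) ^ (P.card + Z.card) * (1 / 2) ^ (P.card + Z.card) = 1 := by
    rw [← mul_pow, mul_one_div_cancel two_ne_zero, one_pow]
  refine (Nat.cast_le (α := ℝ).2 hle).trans ?_
  refine (card_filter_pairs_le Q x _ hQ hQx hd).trans_eq ?_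
  rw [← hcard, pow_add 2 _ (P.card + Z.card), mul_assoc (2 ^ _) (2 ^ _), h2, mul_one]

theorem zero_mem_AT (T : Set ℕ) : 0 ∈ AT T := fun y hy => by simpa using hy

theorem add_mem_AT {T : Set ℕ} {a b : ℕ} (ha : a ∈ AT T) (hb : b ∈ AT T) : a + b ∈ AT T :=
  fun y hy => by rw [add_assoc]; exact ha _ (hb y hy)

theorem mul_mem_AT_s12 {T : Set ℕ} {a : ℕ} (ha : a ∈ AT T) (k : ℕ) : k * a ∈ AT T := by
  induction k with
  | zero => simpa using zero_mem_AT T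
  | succ k ih => rw [add_mul, one_mul]; exact add_mem_AT ih ha

theorem mem_of_mem_AT {T : Set ℕ} (h0 : 0 ∈ T) {a : ℕ} (ha : a ∈ AT T) : a ∈ T := by
  simpa using ha 0 h0

theorem mem_NSet {D : Finset ℕ} {f x : ℕ} :
    x ∈ NSet D f ↔ x = 0 ∨ (∃ l ∈ D, f - l = x) ∨ f < x := by
  simp [NSet, or_assoc]

theorem frob_eq_of_forall {T : Set ℕ} {f : ℕ} (hf : f ∉ T) (h : ∀ x, f < x → x ∈ T) :
    frob T = f := by
  refine IsGreatest.csSup_eq ⟨hf, fun x hx => ?_⟩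
  by_contra hlt
  exact hx (h x (not_le.1 hlt))

theorem finite_setOf_AT_eq {S : Set ℕ} {f : ℕ} (hS : ∀ x, f < x → x ∈ S) :
    {T : Set ℕ | IsNumericalSet T ∧ AT T = S}.Finite := by
  refine (((Set.finite_Iic f).powerset).image (fun A => A ∪ Set.Ioi f)).subset ?_
  rintro T ⟨hT, rfl⟩
  refine ⟨T ∩ Set.Iic f, Set.inter_subset_right, ?_⟩
  ext x
  simp only [Set.mem_union, Set.mem_inter_iff, Set.mem_Iic, Set.mem_Ioi]
  constructor
  · rintro (h | h)
    · exact h.1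
    · exact mem_of_mem_AT hT.1 (hS x h)
  · intro h
    rcases le_or_gt x f with hx | hx
    · exact Or.inl ⟨h, hx⟩
    · exact Or.inr hx

/-- The sets `U` of free elements for which `x` lies in the associated semigroup of
`N(D,f) ∪ U`. -/
noncomputable def freeSetsWithMem (D : Finset ℕ) (t M f x : ℕ) : Finset (Finset ℕ) :=
  open Classical in
  {U ∈ (Finset.Ioo t (f - M)).powerset | x ∈ AT (NSet D f ∪ ↑U)}

section

variable {D : Finset ℕ} {t M f : ℕ}

theorem mem_union_NSet_iff (hD : ∀ d ∈ D, 0 < d ∧ d ≤ t) (hM : t ≤ M)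
    {U : Finset ℕ} {x : ℕ} (hx0 : 0 < x) (hxM : x < f - M) :
    x ∈ NSet D f ∪ (U : Set ℕ) ↔ x ∈ U := by
  rw [Set.mem_union, mem_NSet, Finset.mem_coe]
  constructor
  · rintro ((h | ⟨l, hl, h⟩ | h) | h)
    · omega
    · have := hD l hl
      omega
    · omega
    · exact h
  · exact Or.inr

theorem sub_mem_union_NSet (hD : ∀ d ∈ D, 0 < d ∧ d ≤ t) (hM : t ≤ M) (hf : M < f)
    {U : Finset ℕ} (hU : U ⊆ Finset.Ioo t (f - M)) {j : ℕ} (hj : j ≤ M)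
    (h : f - j ∈ NSet D f ∪ (U : Set ℕ)) : j ∈ D := by
  rw [Set.mem_union, mem_NSet, Finset.mem_coe] at h
  rcases h with (h | ⟨l, hl, h⟩ | h) | h
  · omega
  · have := hD l hl
    obtain rfl : l = j := by omega
    exact hl
  · omega
  · have := Finset.mem_Ioo.1 (hU h)
    omega

theorem card_freeSetsWithMem_sub_le (hD : ∀ d ∈ D, 0 < d ∧ d ≤ t) (hM : t ≤ M) {l k : ℕ}
    (hl : M < l) (hlf : 2 * l < f) (hlM : t + M + l < f) (hk : k ≤ M) (hkl : t + k < l) :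
    ((freeSetsWithMem D t M f (f - l)).card : ℝ) ≤
      2 ^ (f - M - t - 1) * (1 / 2) ^ (1 + (k + 1 - t)) * (3 / 4) ^ (l - M - t - 1) := by
  classical
  set Z := (Finset.range (k + 1) \ D).image (fun j => l - j) with hZ
  have hmemZ : ∀ z ∈ Z, ∃ j, j ≤ k ∧ j ∉ D ∧ l - j = z := by
    intro z hz
    obtain ⟨j, hj, rfl⟩ := Finset.mem_image.1 hz
    simp only [Finset.mem_sdiff, Finset.mem_range] at hj
    exact ⟨j, by omega, hj.2, rfl⟩
  have hZcard : k + 1 - t ≤ Z.card := by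
    rw [hZ, Finset.card_image_of_injOn]
    · have hDt : D.card ≤ t := by
        have : D ⊆ Finset.Icc 1 t := fun d hd => by
          have := hD d hd
          simp only [Finset.mem_Icc]; omega
        simpa using Finset.card_le_card this
      have := Finset.le_card_sdiff D (Finset.range (k + 1))
      simp only [Finset.card_range] at this
      omega
    · intro i hi j hj h
      simp only [Finset.coe_sdiff, Finset.coe_range, Set.mem_sdiff, Set.mem_Iio] at hi hj h
      omega
  have hsub : freeSetsWithMem D t M f (f - l) ⊆
      {U ∈ (Finset.Ioo t (f - M)).powerset | {f - l} ⊆ U ∧ Disjoint U Z ∧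
        ∀ y ∈ Finset.Ioo t (l - M), y ∈ U → (f - l) + y ∈ U} := by
    intro U hU
    simp only [freeSetsWithMem, Finset.mem_filter, Finset.mem_powerset] at hU ⊢
    obtain ⟨hUF, hU⟩ := hU
    refine ⟨hUF, ?_, ?_, ?_⟩
    · rw [Finset.singleton_subset_iff]
      refine (mem_union_NSet_iff hD hM (by omega) (by omega)).1 (mem_of_mem_AT ?_ hU)
      exact Or.inl (mem_NSet.2 (Or.inl rfl))
    · refine Finset.disjoint_right.2 fun z hz hzU => ?_
      obtain ⟨j, hjk, hjD, rfl⟩ := hmemZ z hz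
      have h := hU (l - j) (Or.inr hzU)
      rw [show f - l + (l - j) = f - j by omega] at h
      exact hjD (sub_mem_union_NSet hD hM (by omega) hUF (by omega) h)
    · intro y hy hyU
      have h := hU y (Or.inr hyU)
      rw [Finset.mem_Ioo] at hy
      exact (mem_union_NSet_iff hD hM (by omega) (by omega)).1 h
  have hnotZ : ∀ z, (z < l - k ∨ l < z) → z ∉ Z := by
    intro z hz hzZ
    obtain ⟨j, hjk, -, rfl⟩ := hmemZ z hzZ
    omega
  have hc := card_filter_constraints_le (Finset.Ioo t (f - M)) {f - l} Z
    (Finset.Ioo t (l - M)) (f - l)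
    (by rw [Finset.singleton_subset_iff, Finset.mem_Ioo]; omega)
    (fun z hz => by
      obtain ⟨j, hjk, -, rfl⟩ := hmemZ z hz
      rw [Finset.mem_Ioo]; omega)
    (by
      rw [Finset.disjoint_singleton_left]
      exact hnotZ _ (by omega))
    (fun y hy => by
      rw [Finset.mem_Ioo] at hy
      have := hnotZ y (by omega)
      simp only [Finset.mem_sdiff, Finset.mem_Ioo, Finset.mem_union, Finset.mem_singleton,
        this, or_false]
      omega)
    (fun y hy => by
      rw [Finset.mem_Ioo] at hy
      have := hnotZ (f - l + y) (by omega)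
      simp only [Finset.mem_sdiff, Finset.mem_Ioo, Finset.mem_union, Finset.mem_singleton,
        this, or_false]
      omega)
    (fun y hy => by
      rw [Finset.mem_Ioo] at hy ⊢
      omega)
  simp only [Nat.card_Ioo, Finset.card_singleton] at hc
  calc ((freeSetsWithMem D t M f (f - l)).card : ℝ) ≤ _ := by
        exact_mod_cast Finset.card_le_card hsub
    _ ≤ _ := hc
    _ ≤ _ := by
      have : ((1 : ℝ) / 2) ^ (1 + Z.card) ≤ (1 / 2) ^ (1 + (k + 1 - t)) :=
        pow_le_pow_of_le_one (by norm_num) (by norm_num) (by omega)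
      gcongr

theorem card_freeSetsWithMem_le (hD : ∀ d ∈ D, 0 < d ∧ d ≤ t) (hM : t ≤ M) {x r : ℕ}
    (hrx : r ≤ x) (hx0 : 0 < x) (hxf : M + x + r < f) :
    ((freeSetsWithMem D t M f x).card : ℝ) ≤ 2 ^ (f - M - t - 1) * (3 / 4) ^ (r - t) := by
  classical
  have hsub : freeSetsWithMem D t M f x ⊆
      {U ∈ (Finset.Ioo t (f - M)).powerset | ∀ y ∈ Finset.Ioc t r, y ∈ U → x + y ∈ U} := by
    intro U hU
    simp only [freeSetsWithMem, Finset.mem_filter, Finset.mem_powerset] at hU ⊢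
    refine ⟨hU.1, fun y hy hyU => ?_⟩
    rw [Finset.mem_Ioc] at hy
    exact (mem_union_NSet_iff hD hM (by omega) (by omega)).1 (hU.2 y (Or.inr hyU))
  have hc := card_filter_pairs_le (Finset.Ioc t r) x (Finset.Ioo t (f - M))
    (fun y hy => by rw [Finset.mem_Ioc] at hy; rw [Finset.mem_Ioo]; omega)
    (fun y hy => by rw [Finset.mem_Ioc] at hy; rw [Finset.mem_Ioo]; omega)
    (fun y hy => by rw [Finset.mem_Ioc] at hy ⊢; omega)
  simp only [Nat.card_Ioo, Nat.card_Ioc] at hc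
  refine le_trans ?_ hc
  exact_mod_cast Finset.card_le_card hsub

theorem AT_union_NSet_eq (hD : ∀ d ∈ D, 0 < d ∧ d ≤ t) (hf : 2 * t < f)
    {U : Finset ℕ} (hU : U ⊆ Finset.Ioo t (f - M))
    (h : ∀ x, 0 < x → x < f - M → x ∉ AT (NSet D f ∪ (U : Set ℕ))) :
    AT (NSet D f ∪ (U : Set ℕ)) = NSet D f := by
  ext x
  constructor
  · intro hx
    rcases mem_of_mem_AT (Or.inl (mem_NSet.2 (Or.inl rfl))) hx with hN | hN
    · exact hN
    · have := Finset.mem_Ioo.1 (hU hN)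
      exact absurd hx (h x (by omega) this.2)
  · intro hx
    rcases mem_NSet.1 hx with rfl | ⟨l, hl, rfl⟩ | hxf
    · exact zero_mem_AT _
    · have hlt := hD l hl
      rintro y (hy | hy)
      · rcases mem_NSet.1 hy with rfl | ⟨k, hk, rfl⟩ | hyf
        · exact Or.inl hx
        · have := hD k hk
          exact Or.inl (mem_NSet.2 (Or.inr (Or.inr (by omega))))
        · exact Or.inl (mem_NSet.2 (Or.inr (Or.inr (by omega))))
      · have := Finset.mem_Ioo.1 (hU hy)
        exact Or.inl (mem_NSet.2 (Or.inr (Or.inr (by omega))))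
    · exact fun y _ => Or.inl (mem_NSet.2 (Or.inr (Or.inr (by omega))))

theorem isNumericalSet_union_NSet (hD : ∀ d ∈ D, 0 < d ∧ d ≤ t) (hM : t ≤ M) (hf : M < f)
    {U : Finset ℕ} (hU : U ⊆ Finset.Ioo t (f - M)) :
    IsNumericalSet (NSet D f ∪ (U : Set ℕ)) := by
  refine ⟨Or.inl (mem_NSet.2 (Or.inl rfl)), (Set.finite_Iic f).subset fun x hx => ?_, f, ?_⟩
  · by_contra hlt
    exact hx (Or.inl (mem_NSet.2 (Or.inr (Or.inr (not_le.1 hlt)))))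
  · intro hmem
    have := hD 0 (sub_mem_union_NSet hD hM hf hU (Nat.zero_le _) (by simpa using hmem))
    omega

theorem frob_NSet (hD : ∀ d ∈ D, 0 < d) (hf : 0 < f) : frob (NSet D f) = f := by
  refine frob_eq_of_forall (fun h => ?_) fun x hx => mem_NSet.2 (Or.inr (Or.inr hx))
  rcases mem_NSet.1 h with h | ⟨l, hl, h⟩ | h
  · omega
  · have := hD l hl
    omega
  · omega

end

theorem card_powerset_le_PCount_add {D : Finset ℕ} {t M n : ℕ}
    (hD : ∀ d ∈ D, 0 < d ∧ d ≤ t) (hM : t ≤ M) (hn : M + t < n) :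
    2 ^ (4 * n - M - t - 1) ≤ PCount (NSet D (4 * n)) +
      (∑ l ∈ Finset.Ioo M (2 * n), (freeSetsWithMem D t M (4 * n) (4 * n - l)).card +
        ∑ x ∈ Finset.Ioc n (2 * n), (freeSetsWithMem D t M (4 * n) x).card) := by
  classical
  set f := 4 * n with hf
  set Ω := (Finset.Ioo t (f - M)).powerset with hΩ
  set good := Ω.filter (fun U : Finset ℕ => AT (NSet D f ∪ (U : Set ℕ)) = NSet D f)
  have hcover : Ω ⊆ good ∪ ((Finset.Ioo M (2 * n)).biUnion
      (fun l => freeSetsWithMem D t M f (f - l)) ∪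
      (Finset.Ioc n (2 * n)).biUnion (fun x => freeSetsWithMem D t M f x)) := by
    intro U hU
    have hUF := Finset.mem_powerset.1 hU
    simp only [Finset.mem_union, Finset.mem_biUnion]
    by_cases h : ∀ x, 0 < x → x < f - M → x ∉ AT (NSet D f ∪ (U : Set ℕ))
    · exact Or.inl (Finset.mem_filter.2 ⟨hU, AT_union_NSet_eq hD (by omega) hUF h⟩)
    · push Not at h
      obtain ⟨x, hx0, hxM, hx⟩ := h
      right
      rcases le_or_gt x (2 * n) with hxn | hxn
      · right
        refine ⟨(n / x + 1) * x, ?_, Finset.mem_filter.2 ⟨hU, mul_mem_AT_s12 hx _⟩⟩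
        have h1 : n < (n / x + 1) * x := Nat.lt_mul_of_div_lt (Nat.lt_succ_self _) hx0
        have h2 : n / x * x ≤ n := Nat.div_mul_le_self n x
        rw [Finset.mem_Ioc]
        refine ⟨h1, ?_⟩
        rcases le_or_gt x n with h3 | h3
        · rw [add_mul]; omega
        · rw [Nat.div_eq_of_lt h3]; omega
      · left
        refine ⟨f - x, by rw [Finset.mem_Ioo]; omega, Finset.mem_filter.2 ⟨hU, ?_⟩⟩
        rwa [show f - (f - x) = x by omega]
  have hgoodle : good.card ≤ PCount (NSet D f) := by
    rw [PCount, ← Set.ncard_coe_finset]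
    refine Set.ncard_le_ncard_of_injOn (fun U : Finset ℕ => NSet D f ∪ (U : Set ℕ)) ?_ ?_
      (finite_setOf_AT_eq (f := f) fun x hx => mem_NSet.2 (Or.inr (Or.inr hx)))
    · intro U hU
      have hU' := Finset.mem_filter.1 hU
      exact ⟨isNumericalSet_union_NSet hD hM (by omega) (Finset.mem_powerset.1 hU'.1), hU'.2⟩
    · intro U hU V hV h
      have hU' := Finset.mem_powerset.1 (Finset.mem_filter.1 hU).1
      have hV' := Finset.mem_powerset.1 (Finset.mem_filter.1 hV).1
      have key : ∀ x, t < x → x < f - M → (x ∈ U ↔ x ∈ V) := fun x h1 h2 => by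
        rw [← mem_union_NSet_iff (U := U) hD hM (by omega) h2,
          ← mem_union_NSet_iff (U := V) hD hM (by omega) h2]
        exact Set.ext_iff.1 h x
      ext x
      constructor
      · intro hx
        have := Finset.mem_Ioo.1 (hU' hx)
        exact (key x this.1 this.2).1 hx
      · intro hx
        have := Finset.mem_Ioo.1 (hV' hx)
        exact (key x this.1 this.2).2 hx
  have hcardΩ : Ω.card = 2 ^ (f - M - t - 1) := by simp [hΩ]
  rw [← hcardΩ]
  calc Ω.card ≤ _ := Finset.card_le_card hcover
    _ ≤ _ := (Finset.card_union_le _ _).trans (add_le_add le_rfl (Finset.card_union_le _ _))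
    _ ≤ _ := add_le_add hgoodle (add_le_add Finset.card_biUnion_le Finset.card_biUnion_le)

theorem sum_card_freeSetsWithMem_sub_le {D : Finset ℕ} {t n : ℕ}
    (hD : ∀ d ∈ D, 0 < d ∧ d ≤ t) (hn : 4 * t + 2 < n) :
    ((∑ l ∈ Finset.Ioo (2 * t + 1) (2 * n),
      (freeSetsWithMem D t (2 * t + 1) (4 * n) (4 * n - l)).card : ℕ) : ℝ) ≤
      2 ^ (4 * n - (2 * t + 1) - t - 1) * (1 / 4 + (1 / 2) ^ (t + 1)) := by
  obtain ⟨m, hm⟩ : ∃ m, 2 * n = 2 * t + 2 + (t + m) := ⟨2 * n - (3 * t + 2), by omega⟩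
  have hIoo : Finset.Ioo (2 * t + 1) (2 * n) = Finset.Ico (2 * t + 2) (2 * n) := by
    ext; simp only [Finset.mem_Ioo, Finset.mem_Ico]; omega
  have h1 : ∀ k : ℕ, ∑ i ∈ Finset.range k, ((1 : ℝ) / 2) ^ (3 + i) ≤ 1 / 4 := by
    intro k
    have : ∑ i ∈ Finset.range k, ((1 : ℝ) / 2) ^ (3 + i) = 1 / 4 - 1 / 4 * (1 / 2) ^ k := by
      induction k with
      | zero => simp
      | succ k ih => rw [Finset.sum_range_succ, ih]; ring
    rw [this]
    have : (0 : ℝ) ≤ (1 / 2) ^ k := by positivity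
    linarith
  have h2 : ∀ k : ℕ, ∑ i ∈ Finset.range k, ((3 : ℝ) / 4) ^ i ≤ 4 := by
    intro k
    have : ∑ i ∈ Finset.range k, ((3 : ℝ) / 4) ^ i = 4 - 4 * (3 / 4) ^ k := by
      induction k with
      | zero => simp
      | succ k ih => rw [Finset.sum_range_succ, ih]; ring
    rw [this]
    have : (0 : ℝ) ≤ (3 / 4) ^ k := by positivity
    linarith
  rw [hIoo, Finset.sum_Ico_eq_sum_range, show 2 * n - (2 * t + 2) = t + m by omega,
    Finset.sum_range_add, Nat.cast_add, Nat.cast_sum, Nat.cast_sum, mul_add]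
  refine add_le_add ?_ ?_
  · refine le_trans ?_ (mul_le_mul_of_nonneg_left (h1 t) (by positivity))
    rw [Finset.mul_sum]
    refine Finset.sum_le_sum fun i hi => ?_
    rw [Finset.mem_range] at hi
    have := card_freeSetsWithMem_sub_le (f := 4 * n) (M := 2 * t + 1) (l := 2 * t + 2 + i)
      (k := t + 1 + i) hD (by omega) (by omega) (by omega) (by omega) (by omega) (by omega)
    rwa [show 1 + (t + 1 + i + 1 - t) = 3 + i by omega,
      show 2 * t + 2 + i - (2 * t + 1) - t - 1 = 0 by omega, pow_zero, mul_one] at this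
  · refine le_trans ?_ (mul_le_mul_of_nonneg_left (b := (1 / 2) ^ (t + 3) *
      ∑ i ∈ Finset.range m, ((3 : ℝ) / 4) ^ i) ?_ (by positivity))
    · rw [Finset.mul_sum, Finset.mul_sum]
      refine Finset.sum_le_sum fun i hi => ?_
      rw [Finset.mem_range] at hi
      have := card_freeSetsWithMem_sub_le (f := 4 * n) (M := 2 * t + 1)
        (l := 2 * t + 2 + (t + i)) (k := 2 * t + 1) hD (by omega) (by omega) (by omega)
        (by omega) (by omega) (by omega)
      rwa [show 1 + (2 * t + 1 + 1 - t) = t + 3 by omega,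
        show 2 * t + 2 + (t + i) - (2 * t + 1) - t - 1 = i by omega, mul_assoc] at this
    · calc _ ≤ ((1 : ℝ) / 2) ^ (t + 3) * 4 := by gcongr; exact h2 m
        _ = _ := by ring

theorem sum_card_freeSetsWithMem_le {D : Finset ℕ} {t M n : ℕ}
    (hD : ∀ d ∈ D, 0 < d ∧ d ≤ t) (hM : t ≤ M) (hn : M + t < n) :
    ((∑ x ∈ Finset.Ioc n (2 * n), (freeSetsWithMem D t M (4 * n) x).card : ℕ) : ℝ) ≤
      2 ^ (4 * n - M - t - 1) * (n * (3 / 4) ^ (n - M - t)) := by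
  rw [Nat.cast_sum]
  calc _ ≤ ∑ x ∈ Finset.Ioc n (2 * n), (2 : ℝ) ^ (4 * n - M - t - 1) * (3 / 4) ^ (n - M - t) := by
        refine Finset.sum_le_sum fun x hx => ?_
        rw [Finset.mem_Ioc] at hx
        exact card_freeSetsWithMem_le hD hM (by omega) (by omega) (by omega)
    _ = _ := by
      rw [Finset.sum_const, Nat.card_Ioc, nsmul_eq_mul, show 2 * n - n = n by omega]
      ring

theorem le_density_NSet {D : Finset ℕ} {t n : ℕ} (hD : ∀ d ∈ D, 0 < d ∧ d ≤ t)
    (hn : 4 * t + 2 < n) :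
    (1 / 2) ^ (3 * t + 1) *
      (3 / 4 - (1 / 2) ^ (t + 1) - n * (3 / 4) ^ (n - (2 * t + 1) - t))
      ≤ density (NSet D (4 * n)) := by
  have h1 : ((2 ^ (4 * n - (2 * t + 1) - t - 1) : ℕ) : ℝ) ≤ _ :=
    Nat.cast_le.2 (card_powerset_le_PCount_add (M := 2 * t + 1) (n := n) hD (by omega) (by omega))
  have h2 := sum_card_freeSetsWithMem_sub_le hD hn
  have h3 := sum_card_freeSetsWithMem_le (M := 2 * t + 1) (n := n) hD (by omega) (by omega)
  rw [Nat.cast_add, Nat.cast_add] at h1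
  push_cast at h1 h2 h3
  rw [density, frob_NSet (fun d hd => (hD d hd).1) (by omega), le_div_iff₀ (by positivity),
    show 4 * n - 1 = (3 * t + 1) + (4 * n - (2 * t + 1) - t - 1) by omega, pow_add]
  have h4 : ((1 : ℝ) / 2) ^ (3 * t + 1) * 2 ^ (3 * t + 1) = 1 := by
    rw [← mul_pow]; norm_num
  calc _ = ((1 : ℝ) / 2) ^ (3 * t + 1) * 2 ^ (3 * t + 1) *
        (2 ^ (4 * n - (2 * t + 1) - t - 1) *
          (3 / 4 - (1 / 2) ^ (t + 1) - n * (3 / 4) ^ (n - (2 * t + 1) - t))) := by ring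
    _ ≤ _ := by
      rw [h4]
      linarith

theorem tendsto_nat_mul_pow_sub (k : ℕ) :
    Tendsto (fun n : ℕ => (n : ℝ) * (3 / 4) ^ (n - k)) atTop (𝓝 0) := by
  have h := (tendsto_self_mul_const_pow_of_lt_one (r := (3 / 4 : ℝ))
    (by norm_num) (by norm_num)).mul_const (((3 : ℝ) / 4) ^ k)⁻¹
  rw [zero_mul] at h
  refine h.congr' ?_
  filter_upwards [eventually_ge_atTop k] with n hn
  rw [pow_sub₀ _ (by norm_num) hn, mul_assoc]

theorem stmt12 (D : Finset ℕ) (hD : ∀ d ∈ D, 0 < d) (γ : ℝ)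
    (hγ : Tendsto (fun f : ℕ => density (NSet D f)) atTop (nhds γ)) :
    (2 / 3 * 4 ^ (-((D.sup id : ℕ) : ℤ)) -
        3 * 2 ^ (D.sup id) * 4 ^ (-(2 * ((D.sup id : ℕ) : ℤ) + 1))) / 2 ^ (D.sup id + 1) ≤ γ
      ∧ 0 < γ := by
  set t := D.sup id
  have hDt : ∀ d ∈ D, 0 < d ∧ d ≤ t := fun d hd => ⟨hD d hd, Finset.le_sup (f := id) hd⟩
  have h4 : Tendsto (fun n : ℕ => 4 * n) atTop atTop :=
    tendsto_id.const_mul_atTop' (by norm_num)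
  have hlim := ((tendsto_nat_mul_pow_sub (2 * t + 1 + t)).const_sub
    (3 / 4 - ((1 : ℝ) / 2) ^ (t + 1))).const_mul (((1 : ℝ) / 2) ^ (3 * t + 1))
  have hle : ((1 : ℝ) / 2) ^ (3 * t + 1) * (3 / 4 - (1 / 2) ^ (t + 1) - 0) ≤ γ := by
    refine le_of_tendsto_of_tendsto hlim (hγ.comp h4) ?_
    filter_upwards [eventually_gt_atTop (4 * t + 2)] with n hn
    simpa only [Nat.sub_sub, Function.comp_apply] using le_density_NSet hDt hn
  have hu : (0 : ℝ) < (1 / 2) ^ t := by positivity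
  have hu1 : ((1 : ℝ) / 2) ^ t ≤ 1 := pow_le_one₀ (by norm_num) (by norm_num)
  have e1 : ((1 : ℝ) / 2) ^ (3 * t + 1) = ((1 / 2) ^ t) ^ 3 / 2 := by ring
  have e2 : ((1 : ℝ) / 2) ^ (t + 1) = (1 / 2) ^ t / 2 := by ring
  have e3 : (4 : ℝ) ^ (-(t : ℤ)) = ((1 / 2) ^ t) ^ 2 := by
    rw [zpow_neg, zpow_natCast, ← inv_pow, ← pow_mul, mul_comm t 2, pow_mul]; norm_num
  have e4 : (4 : ℝ) ^ (-(2 * (t : ℤ) + 1)) = ((1 / 2) ^ t) ^ 4 / 4 := by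
    rw [show -(2 * (t : ℤ) + 1) = -(t : ℤ) + -(t : ℤ) + -1 by ring, zpow_add₀ (by norm_num),
      zpow_add₀ (by norm_num), e3]
    norm_num; ring
  have e5 : (2 : ℝ) ^ t = ((1 / 2) ^ t)⁻¹ := by rw [← inv_pow]; norm_num
  rw [e1, e2] at hle
  rw [e3, e4, pow_succ 2 t, e5]
  generalize ((1 : ℝ) / 2) ^ t = u at *
  have hu3 : 0 < u ^ 3 := by positivity
  constructor
  · calc _ = u ^ 3 / 2 * (2 / 3 - 3 / 4 * u) := by
          field_simp
      _ ≤ u ^ 3 / 2 * (3 / 4 - u / 2 - 0) := by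
        gcongr ?_ * ?_
        linarith
      _ ≤ γ := hle
  · refine lt_of_lt_of_le ?_ hle
    have : 0 < 3 / 4 - u / 2 - 0 := by linarith
    positivity
end
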